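/- arXiv:1909.13477 — 2 statements merged into one kernel-verified Lean document; each statement's English description precedes it below -/
import Mathlib

section
/- Let g : ℝ → ℝ be of class C² satisfying (A1)–(A3), let f_z be the associated Stein solution, let X be a random vector in ℝⁿ, W = φ(X), and let (W, W') be an exchangeable pair with Δ = W − W' satisfying E(Δ | X) = λ(g(W) + R) almost surely for a constant λ ∈ (0,1) and an integrable random variable R, with all the expectations below finite. Then for every z ∈ ℝ: E[g(W)f_z(W)] = (1/(2λ))·E[Δ·∫_{−Δ}^0 f_z'(W+t) dt] − E[f_z(W)·R]. -/
open MeasureTheory ProbabilityTheory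

/-- `G(x) = ∫₀ˣ g(t) dt`. -/
noncomputable def Gfun (g : ℝ → ℝ) (x : ℝ) : ℝ := ∫ t in (0:ℝ)..x, g t

/-- The density `p(x) = c₁ e^{-G(x)}`. -/
noncomputable def steinPDF (g : ℝ → ℝ) (c₁ x : ℝ) : ℝ := c₁ * Real.exp (-(Gfun g x))

/-- The distribution function `F` with density `p`. -/
noncomputable def steinCDF (g : ℝ → ℝ) (c₁ z : ℝ) : ℝ := ∫ x in Set.Iic z, steinPDF g c₁ x

/-- The Stein solution `f_z`. -/
noncomputable def steinSol (g : ℝ → ℝ) (c₁ z x : ℝ) : ℝ :=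
  if x ≤ z then steinCDF g c₁ x * (1 - steinCDF g c₁ z) / steinPDF g c₁ x
  else steinCDF g c₁ z * (1 - steinCDF g c₁ x) / steinPDF g c₁ x

/-- The derivative `f_z'` of the Stein solution, given by Stein's equation
`f_z'(x) = g(x) f_z(x) + I(x ≤ z) - F(z)`. -/
noncomputable def steinSol' (g : ℝ → ℝ) (c₁ z x : ℝ) : ℝ :=
  g x * steinSol g c₁ z x + (if x ≤ z then 1 else 0) - steinCDF g c₁ z

lemma hasDerivAt_Gfun {g : ℝ → ℝ} (hg : Continuous g) (x : ℝ) : HasDerivAt (Gfun g) (g x) x :=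
  intervalIntegral.integral_hasDerivAt_right (hg.intervalIntegrable _ _)
    hg.stronglyMeasurable.stronglyMeasurableAtFilter hg.continuousAt

lemma steinPDF_pos {c₁ : ℝ} (hc₁ : 0 < c₁) (g : ℝ → ℝ) (x : ℝ) : 0 < steinPDF g c₁ x :=
  mul_pos hc₁ (Real.exp_pos _)

lemma hasDerivAt_steinPDF {g : ℝ → ℝ} (hg : Continuous g) (c₁ x : ℝ) :
    HasDerivAt (steinPDF g c₁) (-(g x * steinPDF g c₁ x)) x := by
  convert! ((hasDerivAt_Gfun hg x).neg.exp).const_mul c₁ using 1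
  simp only [steinPDF, Pi.neg_apply]
  ring

lemma continuous_steinPDF {g : ℝ → ℝ} (hg : Continuous g) (c₁ : ℝ) :
    Continuous (steinPDF g c₁) :=
  continuous_iff_continuousAt.2 fun x => (hasDerivAt_steinPDF hg c₁ x).continuousAt

/-- The cumulative distribution function has the density as derivative. -/
lemma hasDerivAt_steinCDF {g : ℝ → ℝ} (hg : Continuous g) {c₁ : ℝ}
    (hint : Integrable (steinPDF g c₁)) (x : ℝ) :
    HasDerivAt (steinCDF g c₁) (steinPDF g c₁ x) x := by
  have hp := continuous_steinPDF hg c₁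
  have h : HasDerivAt (fun x => steinCDF g c₁ 0 + ∫ t in (0:ℝ)..x, steinPDF g c₁ t)
      (steinPDF g c₁ x) x :=
    (intervalIntegral.integral_hasDerivAt_right (hp.intervalIntegrable _ _)
      hp.stronglyMeasurable.stronglyMeasurableAtFilter hp.continuousAt).const_add _
  refine h.congr_of_eventuallyEq (Filter.Eventually.of_forall fun y => ?_)
  have := intervalIntegral.integral_Iic_sub_Iic (μ := volume) (a := 0) (b := y)
    hint.integrableOn hint.integrableOn
  simp only [steinCDF]
  linarith

lemma one_sub_steinCDF {g : ℝ → ℝ} {c₁ : ℝ} (hint : Integrable (steinPDF g c₁))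
    (hnorm : (∫ x : ℝ, steinPDF g c₁ x) = 1) (x : ℝ) :
    1 - steinCDF g c₁ x = ∫ y in Set.Ioi x, steinPDF g c₁ y := by
  have := intervalIntegral.integral_Iic_add_Ioi (μ := volume) (b := x)
    hint.integrableOn hint.integrableOn
  simp only [steinCDF]
  linarith

/-- Log-concavity of the density, in the form used for comparing tails. -/
lemma steinPDF_add_mul_le {g : ℝ → ℝ} (hg : Continuous g) (hgm : Monotone g) {c₁ : ℝ}
    {x y s : ℝ} (hxy : x ≤ y) (hs : s ≤ 0) :
    steinPDF g c₁ (s + x) * steinPDF g c₁ y ≤ steinPDF g c₁ x * steinPDF g c₁ (s + y) := by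
  have key : ∀ u : ℝ, ∫ t in s..0, g (t + u) = Gfun g u - Gfun g (s + u) := by
    intro u
    rw [intervalIntegral.integral_comp_add_right, zero_add]
    exact (intervalIntegral.integral_interval_sub_left (hg.intervalIntegrable _ _)
      (hg.intervalIntegrable _ _)).symm
  have hmono : ∫ t in s..0, g (t + x) ≤ ∫ t in s..0, g (t + y) :=
    intervalIntegral.integral_mono_on hs
      (Continuous.intervalIntegrable (by fun_prop) _ _)
      (Continuous.intervalIntegrable (by fun_prop) _ _)
      fun t _ => hgm (by linarith)
  rw [key, key] at hmono
  have hexp : Real.exp (-(Gfun g (s + x)) + -(Gfun g y)) ≤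
      Real.exp (-(Gfun g x) + -(Gfun g (s + y))) := Real.exp_le_exp.2 (by linarith)
  rw [Real.exp_add, Real.exp_add] at hexp
  have := mul_le_mul_of_nonneg_left hexp (mul_self_nonneg c₁)
  simp only [steinPDF]
  linarith

lemma setIntegral_Iic_comp_add (p : ℝ → ℝ) (x : ℝ) :
    ∫ s in Set.Iic 0, p (s + x) = ∫ y in Set.Iic x, p y := by
  simpa using (measurePreserving_add_right volume x).setIntegral_preimage_emb
    (measurableEmbedding_addRight x) p (Set.Iic x)

lemma setIntegral_Ioi_comp_add (p : ℝ → ℝ) (x : ℝ) :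
    ∫ s in Set.Ioi 0, p (s + x) = ∫ y in Set.Ioi x, p y := by
  simpa using (measurePreserving_add_right volume x).setIntegral_preimage_emb
    (measurableEmbedding_addRight x) p (Set.Ioi x)

/-- The ratio of the distribution function to the density is non-decreasing. -/
lemma steinCDF_mul_le {g : ℝ → ℝ} (hg : Continuous g) (hgm : Monotone g) {c₁ : ℝ}
    (hint : Integrable (steinPDF g c₁)) {x y : ℝ} (hxy : x ≤ y) :
    steinCDF g c₁ x * steinPDF g c₁ y ≤ steinPDF g c₁ x * steinCDF g c₁ y := by
  simp only [steinCDF]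
  rw [← setIntegral_Iic_comp_add _ x, ← setIntegral_Iic_comp_add _ y,
    ← integral_mul_const, ← integral_const_mul]
  exact setIntegral_mono_on ((hint.comp_add_right x).mul_const _).integrableOn
    ((hint.comp_add_right y).const_mul _).integrableOn measurableSet_Iic
    fun s hs => steinPDF_add_mul_le hg hgm hxy hs

/-- The ratio of the survival function to the density is non-increasing. -/
lemma one_sub_steinCDF_mul_le {g : ℝ → ℝ} (hg : Continuous g) (hgm : Monotone g) {c₁ : ℝ}
    (hint : Integrable (steinPDF g c₁)) (hnorm : (∫ x : ℝ, steinPDF g c₁ x) = 1)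
    {x y : ℝ} (hxy : x ≤ y) :
    (1 - steinCDF g c₁ y) * steinPDF g c₁ x ≤ steinPDF g c₁ y * (1 - steinCDF g c₁ x) := by
  rw [one_sub_steinCDF hint hnorm, one_sub_steinCDF hint hnorm,
    ← setIntegral_Ioi_comp_add _ x, ← setIntegral_Ioi_comp_add _ y,
    ← integral_mul_const, ← integral_const_mul]
  refine setIntegral_mono_on ((hint.comp_add_right y).mul_const _).integrableOn
    ((hint.comp_add_right x).const_mul _).integrableOn measurableSet_Ioi fun s hs => ?_
  have hs' : -s ≤ 0 := neg_nonpos.2 (le_of_lt hs)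
  have := steinPDF_add_mul_le hg hgm (c₁ := c₁) (add_le_add_right hxy s) hs'
  simp only [neg_add_cancel_left] at this
  linarith

lemma steinCDF_mem_Icc {g : ℝ → ℝ} {c₁ : ℝ} (hc₁ : 0 < c₁) (hint : Integrable (steinPDF g c₁))
    (hnorm : (∫ x : ℝ, steinPDF g c₁ x) = 1) (x : ℝ) : steinCDF g c₁ x ∈ Set.Icc (0:ℝ) 1 := by
  refine ⟨setIntegral_nonneg measurableSet_Iic fun y _ => (steinPDF_pos hc₁ g y).le, ?_⟩
  rw [← sub_nonneg, one_sub_steinCDF hint hnorm]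
  exact setIntegral_nonneg measurableSet_Ioi fun y _ => (steinPDF_pos hc₁ g y).le

/-- The Stein solution is non-negative and attains its maximum at `z`. -/
lemma steinSol_mem_Icc {g : ℝ → ℝ} (hg : Continuous g) (hgm : Monotone g) {c₁ : ℝ}
    (hc₁ : 0 < c₁) (hint : Integrable (steinPDF g c₁))
    (hnorm : (∫ x : ℝ, steinPDF g c₁ x) = 1) (z x : ℝ) :
    steinSol g c₁ z x ∈ Set.Icc 0 (steinSol g c₁ z z) := by
  have hF := steinCDF_mem_Icc hc₁ hint hnorm
  have hpx := steinPDF_pos hc₁ g x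
  have hpz := steinPDF_pos hc₁ g z
  have hz : steinSol g c₁ z z =
      steinCDF g c₁ z * (1 - steinCDF g c₁ z) / steinPDF g c₁ z := by simp [steinSol]
  rw [hz, steinSol]
  split_ifs with h
  · refine ⟨div_nonneg (mul_nonneg (hF x).1 (sub_nonneg.2 (hF z).2)) hpx.le, ?_⟩
    rw [div_le_div_iff₀ hpx hpz]
    have := mul_le_mul_of_nonneg_right (steinCDF_mul_le hg hgm hint h)
      (sub_nonneg.2 (hF z).2)
    linarith
  · refine ⟨div_nonneg (mul_nonneg (hF z).1 (sub_nonneg.2 (hF x).2)) hpx.le, ?_⟩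
    rw [div_le_div_iff₀ hpx hpz]
    have := mul_le_mul_of_nonneg_left
      (one_sub_steinCDF_mul_le hg hgm hint hnorm (not_le.1 h).le) (hF z).1
    linarith

lemma continuous_steinSol {g : ℝ → ℝ} (hg : Continuous g) {c₁ : ℝ} (hc₁ : 0 < c₁)
    (hint : Integrable (steinPDF g c₁)) (z : ℝ) : Continuous (steinSol g c₁ z) := by
  have hp := continuous_steinPDF hg c₁
  have hF : Continuous (steinCDF g c₁) :=
    continuous_iff_continuousAt.2 fun x => (hasDerivAt_steinCDF hg hint x).continuousAt
  have hne : ∀ x, steinPDF g c₁ x ≠ 0 := fun x => (steinPDF_pos hc₁ g x).ne'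
  refine Continuous.if_le ((hF.mul continuous_const).div hp hne)
    ((continuous_const.mul (continuous_const.sub hF)).div hp hne)
    continuous_id continuous_const ?_
  rintro x rfl
  rfl

lemma hasDerivAt_steinSol {g : ℝ → ℝ} (hg : Continuous g) {c₁ : ℝ} (hc₁ : 0 < c₁)
    (hint : Integrable (steinPDF g c₁)) {z x : ℝ} (hx : x ≠ z) :
    HasDerivAt (steinSol g c₁ z) (steinSol' g c₁ z x) x := by
  have hp := hasDerivAt_steinPDF hg c₁ x
  have hF := hasDerivAt_steinCDF hg hint x
  have hne : steinPDF g c₁ x ≠ 0 := (steinPDF_pos hc₁ g x).ne'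
  rcases lt_or_gt_of_ne hx with h | h
  · have hd := (hF.mul_const (1 - steinCDF g c₁ z)).div hp hne
    have he : steinSol g c₁ z =ᶠ[nhds x]
        fun y => steinCDF g c₁ y * (1 - steinCDF g c₁ z) / steinPDF g c₁ y := by
      filter_upwards [Iio_mem_nhds h] with y hy
      simp [steinSol, (Set.mem_Iio.1 hy).le]
    refine (hd.congr_of_eventuallyEq he).congr_deriv ?_
    simp only [steinSol', steinSol, h.le, if_true]
    field_simp
    ring
  · have hd := ((hF.const_sub 1).const_mul (steinCDF g c₁ z)).div hp hne
    have he : steinSol g c₁ z =ᶠ[nhds x]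
        fun y => steinCDF g c₁ z * (1 - steinCDF g c₁ y) / steinPDF g c₁ y := by
      filter_upwards [Ioi_mem_nhds h] with y hy
      simp [steinSol, not_le.2 (Set.mem_Ioi.1 hy)]
    refine (hd.congr_of_eventuallyEq he).congr_deriv ?_
    simp only [steinSol', steinSol, not_le.2 h, if_false]
    field_simp
    ring

/-- Fundamental theorem of calculus for the Stein solution. -/
lemma integral_steinSol' {g : ℝ → ℝ} (hg : Continuous g) {c₁ : ℝ} (hc₁ : 0 < c₁)
    (hint : Integrable (steinPDF g c₁)) (z a b : ℝ) :
    ∫ t in a..b, steinSol' g c₁ z t = steinSol g c₁ z b - steinSol g c₁ z a := by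
  have hc := continuous_steinSol hg hc₁ hint z
  refine integral_eq_of_hasDerivAt_off_countable _ _ (Set.countable_singleton z)
    hc.continuousOn (fun x hx => hasDerivAt_steinSol hg hc₁ hint hx.2) ?_
  have hite : Antitone fun x : ℝ => if x ≤ z then (1:ℝ) else 0 := by
    intro x y hxy
    dsimp only
    split_ifs with h₁ h₂ <;> first | exact absurd (hxy.trans h₁) h₂ | norm_num
  exact (((hg.mul hc).intervalIntegrable a b).add hite.intervalIntegrable).sub
    intervalIntegrable_const

/-- For an exchangeable pair and bounded `f`, antisymmetry expresses the expected product of the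
increments of the pair and of `f` through `f` at the first coordinate alone. -/
lemma integral_sub_mul_of_exchangeable {Ω : Type*} [MeasurableSpace Ω] {μ : Measure Ω}
    {W W' : Ω → ℝ} (hW : Measurable W) (hW' : Measurable W')
    (hexch : Measure.map (fun ω => (W ω, W' ω)) μ = Measure.map (fun ω => (W' ω, W ω)) μ)
    (hΔ : Integrable (fun ω => W ω - W' ω) μ) {f : ℝ → ℝ} (hf : Measurable f) {C : ℝ}
    (hC : ∀ x, ‖f x‖ ≤ C) :
    ∫ ω, (W ω - W' ω) * (f (W ω) - f (W' ω)) ∂μ = 2 * ∫ ω, f (W ω) * (W ω - W' ω) ∂μ := by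
  have h₁ : Integrable (fun ω => f (W ω) * (W ω - W' ω)) μ :=
    hΔ.bdd_mul (hf.comp hW).aestronglyMeasurable (Filter.Eventually.of_forall fun ω => hC _)
  have h₂ : Integrable (fun ω => f (W' ω) * (W ω - W' ω)) μ :=
    hΔ.bdd_mul (hf.comp hW').aestronglyMeasurable (Filter.Eventually.of_forall fun ω => hC _)
  have hmeas : Measurable fun q : ℝ × ℝ => f q.1 * (q.1 - q.2) := by fun_prop
  have hswap : ∫ ω, f (W ω) * (W ω - W' ω) ∂μ = ∫ ω, f (W' ω) * (W' ω - W ω) ∂μ := by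
    have e₁ := integral_map (μ := μ) (hW.prodMk hW').aemeasurable hmeas.aestronglyMeasurable
    have e₂ := integral_map (μ := μ) (hW'.prodMk hW).aemeasurable hmeas.aestronglyMeasurable
    rw [← e₁, ← e₂, hexch]
  have hneg : ∫ ω, f (W' ω) * (W' ω - W ω) ∂μ = -∫ ω, f (W' ω) * (W ω - W' ω) ∂μ := by
    rw [← integral_neg]
    congr with ω
    ring
  have hsplit : ∫ ω, (W ω - W' ω) * (f (W ω) - f (W' ω)) ∂μ =
      ∫ ω, f (W ω) * (W ω - W' ω) ∂μ - ∫ ω, f (W' ω) * (W ω - W' ω) ∂μ := by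
    rw [← integral_sub h₁ h₂]
    congr with ω
    ring
  linarith

/-- The basic exchangeable-pair identity:
`E[g(W)f_z(W)] = (1/(2λ)) E[Δ ∫_{-Δ}^0 f_z'(W+t) dt] - E[f_z(W) R]`. -/
theorem stmt13 {Ω : Type*} [MeasurableSpace Ω] (μ : Measure Ω) [IsProbabilityMeasure μ]
    (g : ℝ → ℝ) (c₁ : ℝ)
    -- (A1)
    (hgm : Monotone g) (hsign : ∀ x : ℝ, 0 ≤ x * g x)
    -- (A2)
    (hg2 : ContDiff ℝ 2 g) (hgineq : ∀ x : ℝ, 0 ≤ 2 * (deriv g x) ^ 2 - g x * deriv (deriv g) x)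
    -- normalization
    (hc₁ : 0 < c₁) (hnorm : (∫ x : ℝ, steinPDF g c₁ x) = 1)
    -- (A3)
    (hbot : Filter.Tendsto (fun x => g x * steinPDF g c₁ x) Filter.atBot (nhds 0))
    (htop : Filter.Tendsto (fun x => g x * steinPDF g c₁ x) Filter.atTop (nhds 0))
    (m : ℕ) (X : Ω → (Fin m → ℝ)) (hXm : Measurable X)
    (φ : (Fin m → ℝ) → ℝ) (hφ : Measurable φ)
    (W W' : Ω → ℝ) (hWdef : ∀ ω, W ω = φ (X ω)) (hW'm : Measurable W')
    -- `(W, W')` is an exchangeable pair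
    (hexch : Measure.map (fun ω => (W ω, W' ω)) μ = Measure.map (fun ω => (W' ω, W ω)) μ)
    (lam : ℝ) (hlam : lam ∈ Set.Ioo (0:ℝ) 1)
    (R : Ω → ℝ) (hR : Integrable R μ)
    (hΔint : Integrable (fun ω => W ω - W' ω) μ)
    -- `E(Δ | X) = λ (g(W) + R)` a.s.
    (hlin : μ[fun ω => W ω - W' ω | MeasurableSpace.comap X (inferInstance :
        MeasurableSpace (Fin m → ℝ))] =ᵐ[μ] fun ω => lam * (g (W ω) + R ω))
    -- finiteness of all expectations involved
    (hint1 : ∀ z : ℝ, Integrable (fun ω => g (W ω) * steinSol g c₁ z (W ω)) μ)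
    (hint2 : ∀ z : ℝ, Integrable (fun ω => (W ω - W' ω) *
        ∫ t in (-(W ω - W' ω))..(0:ℝ), steinSol' g c₁ z (W ω + t)) μ)
    (hint3 : ∀ z : ℝ, Integrable (fun ω => steinSol g c₁ z (W ω) * R ω) μ) :
    ∀ z : ℝ,
      ∫ ω, g (W ω) * steinSol g c₁ z (W ω) ∂μ =
        (1 / (2 * lam)) * ∫ ω, ((W ω - W' ω) *
            ∫ t in (-(W ω - W' ω))..(0:ℝ), steinSol' g c₁ z (W ω + t)) ∂μ
        - ∫ ω, steinSol g c₁ z (W ω) * R ω ∂μ := by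
  intro z
  have hg : Continuous g := hg2.continuous
  have hint : Integrable (steinPDF g c₁) :=
    Integrable.of_integral_ne_zero (by rw [hnorm]; exact one_ne_zero)
  have hf : Measurable (steinSol g c₁ z) := (continuous_steinSol hg hc₁ hint z).measurable
  have hC : ∀ x, ‖steinSol g c₁ z x‖ ≤ steinSol g c₁ z z := fun x => by
    have h := steinSol_mem_Icc hg hgm hc₁ hint hnorm z x
    rw [Real.norm_of_nonneg h.1]
    exact h.2
  obtain rfl : W = fun ω => φ (X ω) := funext hWdef
  have hW : Measurable fun ω => φ (X ω) := hφ.comp hXm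
  have hfW : StronglyMeasurable[MeasurableSpace.comap X inferInstance]
      fun ω => steinSol g c₁ z (φ (X ω)) :=
    ((hf.comp hφ).comp (comap_measurable X)).stronglyMeasurable
  have hprod : Integrable (fun ω => steinSol g c₁ z (φ (X ω)) * (φ (X ω) - W' ω)) μ :=
    hΔint.bdd_mul (hf.comp hW).aestronglyMeasurable (Filter.Eventually.of_forall fun ω => hC _)
  have hcond : ∫ ω, steinSol g c₁ z (φ (X ω)) * (φ (X ω) - W' ω) ∂μ =
      lam * (∫ ω, g (φ (X ω)) * steinSol g c₁ z (φ (X ω)) ∂μ +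
        ∫ ω, steinSol g c₁ z (φ (X ω)) * R ω ∂μ) := by
    rw [← integral_add (hint1 z) (hint3 z), ← integral_const_mul,
      ← integral_condExp hXm.comap_le]
    refine integral_congr_ae ?_
    filter_upwards [condExp_mul_of_stronglyMeasurable_left hfW hprod hΔint, hlin] with ω h₁ h₂
    refine h₁.trans ?_
    rw [Pi.mul_apply, h₂]
    ring
  have hftc : ∀ ω, ∫ t in (-(φ (X ω) - W' ω))..(0:ℝ), steinSol' g c₁ z (φ (X ω) + t) =
      steinSol g c₁ z (φ (X ω)) - steinSol g c₁ z (W' ω) := fun ω => by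
    rw [intervalIntegral.integral_comp_add_left, integral_steinSol' hg hc₁ hint]
    congr 2 <;> ring
  simp only [hftc]
  rw [integral_sub_mul_of_exchangeable hW hW'm hexch hΔint hf hC, hcond]
  have := hlam.1.ne'
  field_simp
  ring
end

section
/- Let (W, W') be an exchangeable pair of real random variables, Δ = W − W', and let Δ* = ψ(W, W') with ψ measurable and symmetric (ψ(w,w') = ψ(w',w)) satisfying Δ* ≥ |Δ| almost surely and E[ΔΔ*] finite. For z ∈ ℝ and λ ∈ (0,1), set J₂ = (1/(2λ))·E[Δ·∫_{−Δ}^0 (I(W+t ≤ z) − I(W ≤ z)) dt]. Then |J₂| ≤ (1/(2λ))·E[ΔΔ*·I(W > z)] and also |J₂| ≤ (1/(2λ))·E[ΔΔ*·I(W' ≤ z)]. -/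
open MeasureTheory ProbabilityTheory

/-- The integral in `J₂` is nonnegative and at most `|Δ|` times the increment of the indicator. -/
lemma indicator_increment_integral_bounds (x y z : ℝ) :
    0 ≤ (∫ t in (-(x - y))..(0 : ℝ),
      ((if x + t ≤ z then (1 : ℝ) else 0) - (if x ≤ z then (1 : ℝ) else 0))) ∧
    (∫ t in (-(x - y))..(0 : ℝ),
      ((if x + t ≤ z then (1 : ℝ) else 0) - (if x ≤ z then (1 : ℝ) else 0))) ≤
      |(if z < x then (1 : ℝ) else 0) - (if z < y then (1 : ℝ) else 0)| * |x - y| := by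
  constructor
  · rcases le_total y x with h | h
    · refine intervalIntegral.integral_nonneg (by linarith) fun t ht => ?_
      have := ht.2
      split_ifs <;> first | (exfalso; linarith) | norm_num
    · rw [intervalIntegral.integral_symm, ← intervalIntegral.integral_neg]
      refine intervalIntegral.integral_nonneg (by linarith) fun t ht => ?_
      have := ht.1
      split_ifs <;> first | (exfalso; linarith) | norm_num
  · have hnorm := intervalIntegral.norm_integral_le_of_norm_le_const
      (a := -(x - y)) (b := 0)
      (f := fun t => (if x + t ≤ z then (1 : ℝ) else 0) - (if x ≤ z then (1 : ℝ) else 0))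
      (C := |(if z < x then (1 : ℝ) else 0) - (if z < y then (1 : ℝ) else 0)|) (by
        intro t ht
        rw [Real.norm_eq_abs]
        rcases Set.mem_uIoc.1 ht with ⟨h₁, h₂⟩ | ⟨h₁, h₂⟩ <;>
          split_ifs <;> first | (exfalso; linarith) | norm_num)
    rw [show (0 : ℝ) - -(x - y) = x - y by ring] at hnorm
    exact (le_abs_self _).trans hnorm

/-- Pointwise two-sided bound on the integrand of `J₂`. -/
lemma mul_indicator_increment_integral_bounds {x y p : ℝ} (z : ℝ) (hp : |x - y| ≤ p) :
    max (y - x) 0 * p * ((if z < x then (1 : ℝ) else 0) - (if z < y then (1 : ℝ) else 0)) ≤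
      (x - y) * (∫ t in (-(x - y))..(0 : ℝ),
        ((if x + t ≤ z then (1 : ℝ) else 0) - (if x ≤ z then (1 : ℝ) else 0))) ∧
    (x - y) * (∫ t in (-(x - y))..(0 : ℝ),
        ((if x + t ≤ z then (1 : ℝ) else 0) - (if x ≤ z then (1 : ℝ) else 0))) ≤
      max (x - y) 0 * p *
        ((if z < x then (1 : ℝ) else 0) - (if z < y then (1 : ℝ) else 0)) := by
  obtain ⟨h0, h1⟩ := indicator_increment_integral_bounds x y z
  set K := ∫ t in (-(x - y))..(0 : ℝ),
    ((if x + t ≤ z then (1 : ℝ) else 0) - (if x ≤ z then (1 : ℝ) else 0))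
  have h2 := h1.trans (mul_le_mul_of_nonneg_left hp (abs_nonneg _))
  rcases le_total y x with h | h
  · have hd : 0 ≤ x - y := sub_nonneg.2 h
    have hs : 0 ≤ (if z < x then (1 : ℝ) else 0) - (if z < y then (1 : ℝ) else 0) := by
      split_ifs <;> first | (exfalso; linarith) | norm_num
    rw [abs_of_nonneg hs] at h2
    rw [max_eq_right (by linarith : y - x ≤ 0), max_eq_left hd]
    constructor
    · simpa using mul_nonneg hd h0
    · linarith [mul_le_mul_of_nonneg_left h2 hd]
  · have hd : 0 ≤ y - x := sub_nonneg.2 h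
    have hs : (if z < x then (1 : ℝ) else 0) - (if z < y then (1 : ℝ) else 0) ≤ 0 := by
      split_ifs <;> first | (exfalso; linarith) | norm_num
    rw [abs_of_nonpos hs] at h2
    rw [max_eq_right (by linarith : x - y ≤ 0), max_eq_left hd]
    constructor
    · linarith [mul_le_mul_of_nonneg_left h2 hd]
    · linarith [mul_nonneg hd h0]

/-- Swapping the members of an exchangeable pair does not change expectations. -/
lemma integral_swap_of_map_eq {Ω : Type*} [MeasurableSpace Ω] {μ : Measure Ω}
    {W W' : Ω → ℝ} (hW : Measurable W) (hW' : Measurable W')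
    (hexch : Measure.map (fun ω => (W ω, W' ω)) μ = Measure.map (fun ω => (W' ω, W ω)) μ)
    {F : ℝ × ℝ → ℝ} (hF : Measurable F) :
    ∫ ω, F (W ω, W' ω) ∂μ = ∫ ω, F (W' ω, W ω) ∂μ := by
  rw [← integral_map (hW.prodMk hW').aemeasurable hF.aestronglyMeasurable, hexch,
    integral_map (hW'.prodMk hW).aemeasurable hF.aestronglyMeasurable]

/-- Bounds on `J₂ = (1/(2λ)) E[Δ ∫_{-Δ}^0 (I(W+t ≤ z) - I(W ≤ z)) dt]` for an
exchangeable pair `(W, W')` with symmetric majorant `Δ* = ψ(W, W') ≥ |Δ|`. -/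
theorem stmt15 {Ω : Type*} [MeasurableSpace Ω] (μ : Measure Ω) [IsProbabilityMeasure μ]
    (W W' : Ω → ℝ) (hWm : Measurable W) (hW'm : Measurable W')
    (hexch : Measure.map (fun ω => (W ω, W' ω)) μ = Measure.map (fun ω => (W' ω, W ω)) μ)
    (ψ : ℝ × ℝ → ℝ) (hψm : Measurable ψ) (hψs : ∀ w w' : ℝ, ψ (w, w') = ψ (w', w))
    (hdom : ∀ᵐ ω ∂μ, |W ω - W' ω| ≤ ψ (W ω, W' ω))
    (hint : Integrable (fun ω => (W ω - W' ω) * ψ (W ω, W' ω)) μ)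
    (z lam : ℝ) (hlam : lam ∈ Set.Ioo (0 : ℝ) 1)
    (hJint : Integrable (fun ω => (W ω - W' ω) *
      ∫ t in (-(W ω - W' ω))..(0 : ℝ),
        ((if W ω + t ≤ z then (1 : ℝ) else 0) - (if W ω ≤ z then (1 : ℝ) else 0))) μ) :
    |(1 / (2 * lam)) * ∫ ω, ((W ω - W' ω) *
        ∫ t in (-(W ω - W' ω))..(0 : ℝ),
          ((if W ω + t ≤ z then (1 : ℝ) else 0) - (if W ω ≤ z then (1 : ℝ) else 0))) ∂μ| ≤
      (1 / (2 * lam)) * ∫ ω, (W ω - W' ω) * ψ (W ω, W' ω) *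
          (if z < W ω then (1 : ℝ) else 0) ∂μ ∧
    |(1 / (2 * lam)) * ∫ ω, ((W ω - W' ω) *
        ∫ t in (-(W ω - W' ω))..(0 : ℝ),
          ((if W ω + t ≤ z then (1 : ℝ) else 0) - (if W ω ≤ z then (1 : ℝ) else 0))) ∂μ| ≤
      (1 / (2 * lam)) * ∫ ω, (W ω - W' ω) * ψ (W ω, W' ω) *
          (if W' ω ≤ z then (1 : ℝ) else 0) ∂μ := by
  have hlt : ∀ {f : ℝ × ℝ → ℝ}, Measurable f →
      Measurable fun q => if z < f q then (1 : ℝ) else 0 := fun hf =>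
    Measurable.ite (measurableSet_lt measurable_const hf) measurable_const measurable_const
  have hX := hlt measurable_fst
  have hY := hlt measurable_snd
  have hWW' := hWm.prodMk hW'm
  have hGm : Measurable fun q : ℝ × ℝ => (q.1 - q.2) * ψ q := by fun_prop
  have hBm : Measurable fun q : ℝ × ℝ =>
      max (q.1 - q.2) 0 * ψ q * (if z < q.2 then (1 : ℝ) else 0) := by fun_prop
  have hAm : Measurable fun q : ℝ × ℝ => max (q.1 - q.2) 0 * ψ q *
      ((if z < q.1 then (1 : ℝ) else 0) - (if z < q.2 then (1 : ℝ) else 0)) := by fun_prop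
  have hGXm : Measurable fun q : ℝ × ℝ =>
      (q.1 - q.2) * ψ q * (if z < q.1 then (1 : ℝ) else 0) := by fun_prop
  have hbound : ∀ {F : ℝ × ℝ → ℝ}, Measurable F →
      (∀ q, |F q| ≤ |(q.1 - q.2) * ψ q|) → Integrable (fun ω => F (W ω, W' ω)) μ :=
    fun hF hle => hint.mono (hF.comp hWW').aestronglyMeasurable
      (Filter.Eventually.of_forall fun ω => hle (W ω, W' ω))
  have hmax : ∀ a : ℝ, |max a 0| ≤ |a| := fun a => by
    rw [abs_of_nonneg (le_max_right a 0)]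
    exact max_le (le_abs_self a) (abs_nonneg a)
  have hfac : ∀ {a b p s : ℝ}, |a| ≤ |b| → |s| ≤ 1 → |a * p * s| ≤ |b * p| :=
    fun {a b p s} ha hs => by
      rw [abs_mul, abs_mul, abs_mul]
      calc |a| * |p| * |s| ≤ |a| * |p| * 1 := by gcongr
        _ ≤ |b| * |p| := by rw [mul_one]; gcongr
  have hB := hbound hBm fun q =>
    hfac (hmax _) (by split_ifs <;> norm_num)
  have hA := hbound hAm fun q =>
    hfac (hmax _) (by split_ifs <;> norm_num)
  have hGX := hbound hGXm fun q =>
    hfac le_rfl (by split_ifs <;> norm_num)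
  have hB' : Integrable (fun ω => max (W' ω - W ω) 0 * ψ (W' ω, W ω) *
      (if z < W ω then (1 : ℝ) else 0)) μ := by
    refine hbound (F := fun q => max (q.2 - q.1) 0 * ψ (q.2, q.1) *
      (if z < q.1 then (1 : ℝ) else 0)) (by fun_prop) fun q => ?_
    rw [hψs q.2 q.1]
    exact hfac ((hmax _).trans_eq (abs_sub_comm _ _)) (by split_ifs <;> norm_num)
  have hA' : Integrable (fun ω => max (W' ω - W ω) 0 * ψ (W' ω, W ω) *
      ((if z < W' ω then (1 : ℝ) else 0) - (if z < W ω then (1 : ℝ) else 0))) μ := by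
    refine hbound (F := fun q => max (q.2 - q.1) 0 * ψ (q.2, q.1) *
      ((if z < q.2 then (1 : ℝ) else 0) - (if z < q.1 then (1 : ℝ) else 0)))
      (by fun_prop) fun q => ?_
    rw [hψs q.2 q.1]
    exact hfac ((hmax _).trans_eq (abs_sub_comm _ _)) (by split_ifs <;> norm_num)
  have hBswap := integral_swap_of_map_eq hWm hW'm hexch hBm
  have hAswap := integral_swap_of_map_eq hWm hW'm hexch hAm
  have hGswap := integral_swap_of_map_eq hWm hW'm hexch hGm
  have hGXswap := integral_swap_of_map_eq hWm hW'm hexch hGXm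
  simp only at hB hA hGX hBswap hAswap hGswap hGXswap
  have hAeq : ∫ ω, max (W ω - W' ω) 0 * ψ (W ω, W' ω) *
      ((if z < W ω then (1 : ℝ) else 0) - (if z < W' ω then (1 : ℝ) else 0)) ∂μ =
      ∫ ω, (W ω - W' ω) * ψ (W ω, W' ω) * (if z < W ω then (1 : ℝ) else 0) ∂μ := by
    refine sub_eq_zero.1 (Eq.trans ?_ (sub_eq_zero.2 hBswap.symm))
    rw [← integral_sub hA hGX, ← integral_sub hB' hB]
    refine integral_congr_ae (Filter.Eventually.of_forall fun ω => ?_)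
    simp only [hψs (W' ω) (W ω)]
    rcases le_total (W' ω) (W ω) with h | h
    · rw [max_eq_left (sub_nonneg.2 h), max_eq_right (sub_nonpos.2 h)]; ring
    · rw [max_eq_right (sub_nonpos.2 h), max_eq_left (sub_nonneg.2 h)]; ring
  have hYeq : ∫ ω, (W ω - W' ω) * ψ (W ω, W' ω) * (if W' ω ≤ z then (1 : ℝ) else 0) ∂μ =
      ∫ ω, (W ω - W' ω) * ψ (W ω, W' ω) * (if z < W ω then (1 : ℝ) else 0) ∂μ := by
    have hG0 : ∫ ω, (W ω - W' ω) * ψ (W ω, W' ω) ∂μ = 0 := by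
      have hneg : ∫ ω, (W' ω - W ω) * ψ (W' ω, W ω) ∂μ =
          -∫ ω, (W ω - W' ω) * ψ (W ω, W' ω) ∂μ := by
        rw [← integral_neg]
        refine integral_congr_ae (Filter.Eventually.of_forall fun ω => ?_)
        simp only [hψs (W' ω) (W ω)]
        ring
      linarith
    have hGX' : Integrable (fun ω => (W' ω - W ω) * ψ (W' ω, W ω) *
        (if z < W' ω then (1 : ℝ) else 0)) μ := by
      refine hbound (F := fun q => (q.2 - q.1) * ψ (q.2, q.1) *
        (if z < q.2 then (1 : ℝ) else 0)) (by fun_prop) fun q => ?_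
      rw [hψs q.2 q.1]
      exact hfac (abs_sub_comm _ _).le (by split_ifs <;> norm_num)
    refine Eq.trans ?_ ((congrArg₂ (· + ·) hG0 hGXswap.symm).trans (zero_add _))
    rw [← integral_add hint hGX']
    refine integral_congr_ae (Filter.Eventually.of_forall fun ω => ?_)
    simp only [hψs (W' ω) (W ω)]
    split_ifs <;> first | (exfalso; linarith) | ring
  have hupper := integral_mono_ae hJint hA
    (hdom.mono fun ω h => (mul_indicator_increment_integral_bounds z h).2)
  have hlower := integral_mono_ae hA'.neg hJint (hdom.mono fun ω h => by
    have := (mul_indicator_increment_integral_bounds z h).1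
    simp only [Pi.neg_apply, hψs (W' ω) (W ω)]
    linarith)
  simp only [Pi.neg_apply, integral_neg] at hlower
  rw [← hAswap, hAeq] at hlower
  rw [hAeq] at hupper
  rw [hYeq, and_self, abs_mul, abs_of_pos (by have := hlam.1; positivity : 0 < 1 / (2 * lam))]
  have := hlam.1
  gcongr
  exact abs_le.2 ⟨hlower, hupper⟩
end
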